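/- For any odd prime power q there exists a set E ⊆ F_q^2 with |E| ≥ q(q−1)/2 − q such that no two vectors x, y ∈ E satisfy x · y = 0 (in particular no x ∈ E satisfies x·x = 0). -/

import Mathlib

open Finset

theorem aux_T (F : Type) [Field F] [Fintype F] [DecidableEq F] :
    ∃ T : Finset F, (∀ x ∈ T, ∀ y ∈ T, 1 + x * y ≠ 0) ∧ Fintype.card F ≤ 2 * T.card + 1 := by
  obtain ⟨T, hT, hmax⟩ := Finset.exists_max_image
    ((univ : Finset (Finset F)).filter (fun T => ∀ x ∈ T, ∀ y ∈ T, 1 + x * y ≠ 0))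
    Finset.card ⟨∅, by simp⟩
  rw [mem_filter] at hT
  have hT := hT.2
  have key : ∀ m, m ∉ T → 1 + m * m = 0 ∨ ∃ y ∈ T, 1 + m * y = 0 := by
    intro m hm
    by_contra hcon
    push Not at hcon
    obtain ⟨h1, h2⟩ := hcon
    have := hmax (insert m T) (by
      rw [mem_filter]
      refine ⟨mem_univ _, ?_⟩
      intro x hx y hy
      rcases mem_insert.1 hx with rfl | hx1
      · rcases mem_insert.1 hy with rfl | hy
        · exact h1
        · exact h2 y hy
      · rcases mem_insert.1 hy with rfl | hy
        · rw [mul_comm]; exact h2 x hx1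
        · exact hT x hx1 y hy)
    rw [card_insert_of_notMem hm] at this
    omega
  have h0 : (0 : F) ∈ T := by
    by_contra h
    rcases key 0 h with h | ⟨y, _, h⟩ <;> simp at h
  refine ⟨T, hT, ?_⟩
  have hR : (univ.filter (fun m : F => 1 + m * m = 0)).card ≤ 2 := by
    by_cases hex : ∃ i : F, 1 + i * i = 0
    · obtain ⟨i, hi⟩ := hex
      refine (card_le_card (t := {i, -i}) ?_).trans card_le_two
      intro m hm
      rw [mem_filter] at hm
      have : (m - i) * (m + i) = 0 := by linear_combination hm.2 - hi
      rcases mul_eq_zero.1 this with h | h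
      · simp [sub_eq_zero.1 h]
      · simp [eq_neg_of_add_eq_zero_left h]
    · push Not at hex
      rw [filter_false_of_mem (fun x _ => hex x)]
      simp
  have hsub : (univ : Finset F) ⊆
      (T ∪ (T.erase 0).image (fun m => -m⁻¹)) ∪ univ.filter (fun m : F => 1 + m * m = 0) := by
    intro m _
    simp only [mem_union, mem_image, mem_filter, mem_erase, mem_univ, true_and]
    by_cases hm : m ∈ T
    · exact Or.inl (Or.inl hm)
    rcases key m hm with h | ⟨y, hy, h⟩
    · exact Or.inr h
    · have hy0 : y ≠ 0 := by rintro rfl; simp at h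
      refine Or.inl (Or.inr ⟨y, ⟨hy0, hy⟩, ?_⟩)
      field_simp
      linear_combination -h
  have c1 := card_le_card hsub
  have c2 := card_union_le (T ∪ (T.erase 0).image (fun m => -m⁻¹))
    (univ.filter (fun m : F => 1 + m * m = 0))
  have c3 := card_union_le T ((T.erase 0).image (fun m => -m⁻¹))
  have c4 : ((T.erase 0).image (fun m => -m⁻¹)).card ≤ _ := card_image_le
  rw [card_erase_of_mem h0] at c4
  have c5 : 0 < T.card := card_pos.2 ⟨0, h0⟩
  rw [card_univ] at c1
  omega

theorem stmt_7 (F : Type) [Field F] [Fintype F] (hodd : Odd (Fintype.card F)) :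
    ∃ E : Finset (Fin 2 → F),
      (Fintype.card F : ℝ) * ((Fintype.card F : ℝ) - 1) / 2 - (Fintype.card F : ℝ) ≤ E.card ∧
      ∀ x ∈ E, ∀ y ∈ E, x 0 * y 0 + x 1 * y 1 ≠ 0 := by
  classical
  obtain ⟨T, hT, hc⟩ := aux_T F
  refine ⟨((univ.erase (0 : F)) ×ˢ T).image (fun p => ![p.1, p.1 * p.2]), ?_, ?_⟩
  · rw [card_image_of_injOn, card_product, card_erase_of_mem (mem_univ _), card_univ]
    · have h1 : 1 ≤ Fintype.card F := Fintype.card_pos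
      push_cast [Nat.cast_sub h1]
      have hc' : (Fintype.card F : ℝ) ≤ 2 * T.card + 1 := by exact_mod_cast hc
      have h1' : (1 : ℝ) ≤ Fintype.card F := by exact_mod_cast h1
      nlinarith
    · rintro ⟨a, m⟩ h ⟨b, n⟩ - hab
      have ha : a ≠ 0 := by simpa using (mem_product.1 (mem_coe.1 h)).1
      have e0 : a = b := by simpa using congrFun hab 0
      have e1 : a * m = b * n := by simpa using congrFun hab 1
      subst e0
      rw [mul_left_cancel₀ ha e1]
  · intro x hx y hy
    obtain ⟨⟨a, m⟩, h, rfl⟩ := mem_image.1 hx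
    obtain ⟨⟨b, n⟩, h', rfl⟩ := mem_image.1 hy
    rw [mem_product] at h h'
    have ha : a ≠ 0 := by simpa using h.1
    have hb : b ≠ 0 := by simpa using h'.1
    have := mul_ne_zero (mul_ne_zero ha hb) (hT m h.2 n h'.2)
    intro h0
    apply this
    simp at h0
    linear_combination h0
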